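/- arXiv:2412.10551 — 5 statements merged into one kernel-verified Lean document; each statement's English description precedes it below -/
import Mathlib

section
/- For every U ∈ ℓ²(ℤ;ℂ), the sequence F_AL(U) − q²(Δ_d q) belongs to ℓ²(ℤ;ℂ) and satisfies the bound ‖F_AL(U) − q²(Δ_d q)‖_{ℓ²} ≤ 2‖U‖_{ℓ²}³ + 6q‖U‖_{ℓ²}² + 8q²‖U‖_{ℓ²}. -/
noncomputable section

/-- The space `ℓ²(ℤ;ℂ)` of square-summable complex sequences. -/
abbrev l2Z : Type := lp (fun _ : ℤ => ℂ) 2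

/-- Discrete Laplacian `(Δ_d u)_n = u_{n+1} - 2 u_n + u_{n-1}`. -/
def discLap (u : ℤ → ℂ) (n : ℤ) : ℂ := u (n + 1) - 2 * u n + u (n - 1)

/-- The step background: `q_n = q_-` for `n ≤ 0` and `q_n = q_+` for `n ≥ 1`. -/
def stepBg (qm qp : ℂ) (n : ℤ) : ℂ := if n ≤ 0 then qm else qp

/-- The ℓ² norm `(Σ_{n ∈ ℤ} |f n|²)^{1/2}` of a complex sequence. -/
def l2norm (f : ℤ → ℂ) : ℝ := Real.sqrt (∑' n : ℤ, ‖f n‖ ^ 2)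

/-- Ablowitz–Ladik nonlinearity
`F_AL(U)_n = -2q²(U_n+q_n) + |U_n+q_n|²(U_{n+1}+U_{n-1}+q_{n+1}+q_{n-1})`. -/
def F_AL (q : ℝ) (qm qp : ℂ) (U : ℤ → ℂ) (n : ℤ) : ℂ :=
  -(2 * (q : ℂ) ^ 2) * (U n + stepBg qm qp n)
    + (‖U n + stepBg qm qp n‖ : ℂ) ^ 2
      * (U (n + 1) + U (n - 1) + stepBg qm qp (n + 1) + stepBg qm qp (n - 1))

/-- DNLS nonlinearity `F_DNLS(V)_n = 2(|V_n+q_n|² - q²)(V_n+q_n)`. -/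
def F_DNLS (q : ℝ) (qm qp : ℂ) (V : ℤ → ℂ) (n : ℤ) : ℂ :=
  2 * ((‖V n + stepBg qm qp n‖ : ℂ) ^ 2 - (q : ℂ) ^ 2) * (V n + stepBg qm qp n)

/-- `U` is a continuously differentiable `ℓ²`-valued solution of the modified
Ablowitz–Ladik equation `i U̇_n + κ(Δ_d U)_n + κ(Δ_d q)_n + F_AL(U)_n = 0` on `[0,T]`. -/
def IsModALSol (κ q : ℝ) (qm qp : ℂ) (T : ℝ) (U : ℝ → l2Z) : Prop :=
  ∃ U' : ℝ → l2Z,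
    ContinuousOn U' (Set.Icc 0 T) ∧
    (∀ t ∈ Set.Icc (0:ℝ) T, HasDerivWithinAt U (U' t) (Set.Icc 0 T) t) ∧
    (∀ t ∈ Set.Icc (0:ℝ) T, ∀ n : ℤ,
      Complex.I * U' t n + (κ : ℂ) * discLap (⇑(U t)) n
        + (κ : ℂ) * discLap (stepBg qm qp) n + F_AL q qm qp (⇑(U t)) n = 0)

/-- `V` is a continuously differentiable `ℓ²`-valued solution of the modified
DNLS equation `i V̇_n + κ(Δ_d V)_n + κ(Δ_d q)_n + F_DNLS(V)_n = 0` on `[0,T]`. -/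
def IsModDNLSSol (κ q : ℝ) (qm qp : ℂ) (T : ℝ) (V : ℝ → l2Z) : Prop :=
  ∃ V' : ℝ → l2Z,
    ContinuousOn V' (Set.Icc 0 T) ∧
    (∀ t ∈ Set.Icc (0:ℝ) T, HasDerivWithinAt V (V' t) (Set.Icc 0 T) t) ∧
    (∀ t ∈ Set.Icc (0:ℝ) T, ∀ n : ℤ,
      Complex.I * V' t n + (κ : ℂ) * discLap (⇑(V t)) n
        + (κ : ℂ) * discLap (stepBg qm qp) n + F_DNLS q qm qp (⇑(V t)) n = 0)

theorem l2norm_eq_norm (f : l2Z) : l2norm (⇑f) = ‖f‖ := by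
  rw [lp.norm_eq_tsum_rpow (by norm_num), l2norm, Real.sqrt_eq_rpow]
  norm_num

/-- The sequence of absolute values of an `ℓ²` sequence, translated by `k`. -/
theorem exists_lp_norm_shift (U : l2Z) (k : ℤ) :
    ∃ A : lp (fun _ : ℤ => ℝ) 2, (∀ n, A n = ‖U (n + k)‖) ∧ ‖A‖ = ‖U‖ := by
  have hs : Summable fun n : ℤ => ‖U (n + k)‖ ^ (2 : ENNReal).toReal :=
    (Equiv.addRight k).summable_iff.2 ((lp.memℓp U).summable (by norm_num))
  refine ⟨⟨fun n => ‖U (n + k)‖, memℓp_gen (by simpa using hs)⟩, fun n => rfl, ?_⟩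
  rw [lp.norm_eq_tsum_rpow (by norm_num), lp.norm_eq_tsum_rpow (by norm_num)]
  congr 1
  simpa using (Equiv.addRight k).tsum_eq (fun n : ℤ => ‖U n‖ ^ (2 : ENNReal).toReal)

/-- If `|b| = q`, then `||u + b|² - q²| ≤ |u|² + 2q|u|`. -/
theorem abs_norm_add_sq_sub_sq_le {q : ℝ} {b : ℂ} (hb : ‖b‖ = q) (u : ℂ) :
    |‖u + b‖ ^ 2 - q ^ 2| ≤ ‖u‖ ^ 2 + 2 * q * ‖u‖ := by
  have h1 : |‖u + b‖ - q| ≤ ‖u‖ := by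
    simpa [hb] using abs_norm_sub_norm_le (u + b) b
  have h2 : ‖u + b‖ ≤ ‖u‖ + q := hb ▸ norm_add_le u b
  have hq : 0 ≤ q := hb ▸ norm_nonneg b
  rw [sq_sub_sq, abs_mul, abs_of_nonneg (by positivity)]
  calc (‖u + b‖ + q) * |‖u + b‖ - q| ≤ (‖u‖ + q + q) * ‖u‖ := by gcongr
    _ = _ := by ring

theorem norm_stepBg {q : ℝ} {qm qp : ℂ} (hqm : ‖qm‖ = q) (hqp : ‖qp‖ = q) (n : ℤ) :
    ‖stepBg qm qp n‖ = q := by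
  unfold stepBg
  split_ifs <;> assumption

theorem norm_F_AL_sub_le {q : ℝ} {qm qp : ℂ} (hqm : ‖qm‖ = q) (hqp : ‖qp‖ = q)
    (U : ℤ → ℂ) (n : ℤ) :
    ‖F_AL q qm qp U n - (q : ℂ) ^ 2 * discLap (stepBg qm qp) n‖ ≤
      2 * q ^ 2 * ‖U n‖ + q ^ 2 * (‖U (n + 1)‖ + ‖U (n - 1)‖)
        + (‖U n‖ ^ 2 + 2 * q * ‖U n‖) * (‖U (n + 1)‖ + ‖U (n - 1)‖ + 2 * q) := by
  have hq : 0 ≤ q := hqm ▸ norm_nonneg qm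
  have hb := norm_stepBg hqm hqp
  set b := stepBg qm qp
  have hF : F_AL q qm qp U n - (q : ℂ) ^ 2 * discLap b n =
      -(2 * (q : ℂ) ^ 2 * U n) + (q : ℂ) ^ 2 * (U (n + 1) + U (n - 1))
        + ((‖U n + b n‖ ^ 2 - q ^ 2 : ℝ) : ℂ)
          * (U (n + 1) + U (n - 1) + (b (n + 1) + b (n - 1))) := by
    simp only [F_AL, discLap]
    push_cast
    ring
  have hU : ‖U (n + 1) + U (n - 1)‖ ≤ ‖U (n + 1)‖ + ‖U (n - 1)‖ := norm_add_le _ _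
  have hB : ‖b (n + 1) + b (n - 1)‖ ≤ 2 * q :=
    (norm_add_le _ _).trans_eq (by rw [hb, hb]; ring)
  rw [hF]
  refine (norm_add₃_le).trans ?_
  rw [norm_neg, norm_mul, norm_mul, norm_mul, norm_mul, Complex.norm_real, Real.norm_eq_abs,
    norm_pow, Complex.norm_real, Real.norm_of_nonneg hq, Complex.norm_two]
  gcongr
  · exact abs_norm_add_sq_sub_sq_le (hb n) (U n)
  · exact (norm_add_le _ _).trans (add_le_add hU hB)

/-- `F_AL(U) - q²(Δ_d q)` lies in `ℓ²` with the bound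
`‖F_AL(U) - q²Δ_d q‖ ≤ 2‖U‖³ + 6q‖U‖² + 8q²‖U‖`. -/
theorem F_AL_mem_l2_and_bound
    (q : ℝ) (hq : 0 < q) (qm qp : ℂ) (hqm : ‖qm‖ = q) (hqp : ‖qp‖ = q) (U : l2Z) :
    Memℓp (fun n => F_AL q qm qp (⇑U) n - (q : ℂ) ^ 2 * discLap (stepBg qm qp) n) 2 ∧
    l2norm (fun n => F_AL q qm qp (⇑U) n - (q : ℂ) ^ 2 * discLap (stepBg qm qp) n)
      ≤ 2 * ‖U‖ ^ 3 + 6 * q * ‖U‖ ^ 2 + 8 * q ^ 2 * ‖U‖ := by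
  obtain ⟨A, hA, hAn⟩ := exists_lp_norm_shift U 0
  obtain ⟨P, hP, hPn⟩ := exists_lp_norm_shift U 1
  obtain ⟨M, hM, hMn⟩ := exists_lp_norm_shift U (-1)
  set N := ‖U‖
  have hN : 0 ≤ N := norm_nonneg U
  let G := (6 * q ^ 2 + 2 * q * N) • A + (q ^ 2 + N ^ 2 + 2 * q * N) • (P + M)
  have hG : ∀ n, ‖F_AL q qm qp (⇑U) n - (q : ℂ) ^ 2 * discLap (stepBg qm qp) n‖ ≤ G n := by
    intro n
    have hGn : G n = (6 * q ^ 2 + 2 * q * N) * ‖U n‖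
        + (q ^ 2 + N ^ 2 + 2 * q * N) * (‖U (n + 1)‖ + ‖U (n - 1)‖) := by
      change (6 * q ^ 2 + 2 * q * N) * A n + (q ^ 2 + N ^ 2 + 2 * q * N) * (P n + M n) = _
      simp only [hA, hP, hM, add_zero, sub_eq_add_neg]
    have hle : ‖U n‖ ≤ N := lp.norm_apply_le_norm (by norm_num) U n
    rw [hGn]
    refine (norm_F_AL_sub_le hqm hqp U n).trans ?_
    have hs : 0 ≤ ‖U (n + 1)‖ + ‖U (n - 1)‖ := by positivity
    generalize ‖U (n + 1)‖ + ‖U (n - 1)‖ = s at *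
    have ha := norm_nonneg (U n)
    generalize ‖U n‖ = a at *
    have h1 : a ^ 2 * s ≤ N ^ 2 * s := by gcongr
    have h2 : q * (a * a) ≤ q * (N * a) := by gcongr
    have h3 : q * (a * s) ≤ q * (N * s) := by gcongr
    nlinarith
  have hmem : Memℓp (fun n => F_AL q qm qp (⇑U) n
      - (q : ℂ) ^ 2 * discLap (stepBg qm qp) n) 2 := (lp.memℓp G).mono hG
  refine ⟨hmem, ?_⟩
  let F : l2Z := ⟨_, hmem⟩
  calc l2norm (⇑F) = ‖F‖ := l2norm_eq_norm F
    _ ≤ ‖G‖ := lp.norm_mono (by norm_num) fun n => (hG n).trans (le_abs_self _)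
    _ ≤ ‖(6 * q ^ 2 + 2 * q * N) • A‖ + ‖(q ^ 2 + N ^ 2 + 2 * q * N) • (P + M)‖ :=
      norm_add_le _ _
    _ ≤ (6 * q ^ 2 + 2 * q * N) * N + (q ^ 2 + N ^ 2 + 2 * q * N) * (N + N) := by
      rw [norm_smul, norm_smul, Real.norm_of_nonneg (by positivity),
        Real.norm_of_nonneg (by positivity), hAn]
      gcongr
      exact (norm_add_le _ _).trans_eq (by rw [hPn, hMn])
    _ = _ := by ring
end
end

section
/- Assume the background is constant, q_+ = q_−, and let 0 < ε < 1. Let U, V : [0,T_c] → ℓ²(ℤ;ℂ) be continuously differentiable solutions of the modified Ablowitz–Ladik equation and the modified discrete nonlinear Schrödinger equation, respectively, such that ‖U(0) − V(0)‖_{ℓ²} ≤ ε³, q ≤ ε, and ‖U(t)‖_{ℓ²} ≤ ε, ‖V(t)‖_{ℓ²} ≤ ε for all t ∈ [0,T_c]. Then for all t ∈ [0,T_c], ‖U(t) − V(t)‖_{ℓ²} ≤ ε³ + α t, where α = 3ε³ + 9qε² + 12q²ε. -/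
noncomputable section

/-- `f` is the coordinate function of an element of `ℓ²(ℤ;ℂ)` of norm at most `C`. -/
def L2Bdd (f : ℤ → ℂ) (C : ℝ) : Prop := ∃ w : l2Z, (∀ n, w n = f n) ∧ ‖w‖ ≤ C

lemma L2Bdd.add {f g : ℤ → ℂ} {C C' : ℝ} (hf : L2Bdd f C) (hg : L2Bdd g C') :
    L2Bdd (fun n => f n + g n) (C + C') := by
  obtain ⟨w, hw, hwC⟩ := hf
  obtain ⟨z, hz, hzC⟩ := hg
  refine ⟨w + z, fun n => ?_, (norm_add_le _ _).trans (add_le_add hwC hzC)⟩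
  rw [lp.coeFn_add, Pi.add_apply, hw, hz]

lemma l2Z_sum_sq_le (u : l2Z) (s : Finset ℤ) : ∑ n ∈ s, ‖u n‖ ^ 2 ≤ ‖u‖ ^ 2 := by
  have h := lp.sum_rpow_le_norm_rpow (p := 2) (by norm_num) u s
  simpa using h

lemma L2Bdd.of_sum_le {f : ℤ → ℂ} {C : ℝ} (hC : 0 ≤ C)
    (h : ∀ s : Finset ℤ, ∑ n ∈ s, ‖f n‖ ^ 2 ≤ C ^ 2) : L2Bdd f C := by
  have hf : Memℓp f 2 := memℓp_gen' (C := C ^ 2) (fun s => by simpa using h s)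
  refine ⟨⟨f, hf⟩, fun n => rfl, ?_⟩
  refine lp.norm_le_of_forall_sum_le (by norm_num) hC (fun s => ?_)
  simpa using h s

lemma L2Bdd.of_le_mul {f : ℤ → ℂ} {u : l2Z} {C : ℝ} (hC : 0 ≤ C)
    (h : ∀ n, ‖f n‖ ≤ C * ‖u n‖) : L2Bdd f (C * ‖u‖) := by
  refine .of_sum_le (by positivity) (fun s => ?_)
  calc ∑ n ∈ s, ‖f n‖ ^ 2 ≤ ∑ n ∈ s, C ^ 2 * ‖u n‖ ^ 2 := by
        refine Finset.sum_le_sum (fun n _ => ?_)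
        rw [← mul_pow]
        exact pow_le_pow_left₀ (norm_nonneg _) (h n) 2
    _ ≤ (C * ‖u‖) ^ 2 := by
        rw [← Finset.mul_sum, mul_pow]
        exact mul_le_mul_of_nonneg_left (l2Z_sum_sq_le u s) (sq_nonneg C)

lemma L2Bdd.mono {f : ℤ → ℂ} {C C' : ℝ} (hf : L2Bdd f C) (h : C ≤ C') : L2Bdd f C' := by
  obtain ⟨w, hw, hwC⟩ := hf
  exact ⟨w, hw, hwC.trans h⟩

/-- Translations preserve the `ℓ²` norm. -/
lemma L2Bdd.shift (u : l2Z) (k : ℤ) : L2Bdd (fun n => u (n + k)) ‖u‖ := by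
  refine .of_sum_le (norm_nonneg u) (fun s => ?_)
  have h := l2Z_sum_sq_le u (s.map (Equiv.addRight k).toEmbedding)
  simpa using h

lemma L2Bdd.mul_left {f : ℤ → ℂ} {C : ℝ} (hf : L2Bdd f C) (a : ℂ) :
    L2Bdd (fun n => a * f n) (‖a‖ * C) := by
  obtain ⟨w, hw, hwC⟩ := hf
  refine ⟨a • w, fun n => ?_, (norm_smul_le a w).trans ?_⟩
  · rw [lp.coeFn_smul, Pi.smul_apply, hw, smul_eq_mul]
  · gcongr

lemma l2Z_norm_apply_le (u : l2Z) (n : ℤ) : ‖u n‖ ≤ ‖u‖ :=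
  lp.norm_apply_le_norm (by norm_num) u n

/-- Three neighbouring coordinates together carry at most the full `ℓ²` norm. -/
lemma l2Z_three_sq_le (u : l2Z) (n : ℤ) :
    ‖u n‖ ^ 2 + ‖u (n + 1)‖ ^ 2 + ‖u (n - 1)‖ ^ 2 ≤ ‖u‖ ^ 2 := by
  have h := l2Z_sum_sq_le u {n, n + 1, n - 1}
  rw [Finset.sum_insert (by simp only [Finset.mem_insert, Finset.mem_singleton]; omega),
    Finset.sum_insert (by simp only [Finset.mem_singleton]; omega), Finset.sum_singleton] at h
  linarith

/-- The sum of two neighbours is controlled by the `ℓ²` mass away from their centre. -/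
lemma l2Z_neighbour_sq_le (u : l2Z) {ε : ℝ} (hu : ‖u‖ ≤ ε) (n : ℤ) :
    ‖u (n + 1) + u (n - 1)‖ ^ 2 ≤ 2 * (ε ^ 2 - ‖u n‖ ^ 2) := by
  have h := l2Z_three_sq_le u n
  have h1 : ‖u‖ ^ 2 ≤ ε ^ 2 := pow_le_pow_left₀ (norm_nonneg _) hu 2
  have h2 := pow_le_pow_left₀ (norm_nonneg _) (norm_add_le (u (n + 1)) (u (n - 1))) 2
  nlinarith [sq_nonneg (‖u (n + 1)‖ - ‖u (n - 1)‖)]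

open ComplexConjugate

lemma norm_conj_mul_add_le (c u : ℂ) : ‖conj c * u + c * conj u‖ ≤ 2 * ‖c‖ * ‖u‖ := by
  refine (norm_add_le _ _).trans (le_of_eq ?_)
  simp only [norm_mul, RCLike.norm_conj]
  ring

/-- The quadratic terms in which the two nonlinearities interact. -/
lemma L2Bdd.quadratic (u v : l2Z) (c : ℂ) {ε : ℝ} (hu : ‖u‖ ≤ ε) (hv : ‖v‖ ≤ ε) :
    L2Bdd (fun n => 2 * (u n * conj (u n) - v n * conj (v n)) * c
      + (conj c * u n + c * conj (u n)) * (u (n + 1) + u (n - 1))) (5 * ‖c‖ * ε ^ 2) := by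
  have hc := norm_nonneg c
  have key : ∀ n, ‖2 * (u n * conj (u n) - v n * conj (v n)) * c
      + (conj c * u n + c * conj (u n)) * (u (n + 1) + u (n - 1))‖ ^ 2
      ≤ 4 * ‖c‖ ^ 2 * ε ^ 2 * (5 / 2 * ‖v n‖ ^ 2 + 10 / 3 * ‖u n‖ ^ 2) := by
    intro n
    set r := ‖u (n + 1) + u (n - 1)‖
    set x := ‖u n‖
    set y := ‖v n‖
    have hx : 0 ≤ x := norm_nonneg _
    have hr : 0 ≤ r := norm_nonneg _
    have hy : 0 ≤ y := norm_nonneg _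
    have hyε : y ^ 2 ≤ ε ^ 2 := pow_le_pow_left₀ hy ((l2Z_norm_apply_le v n).trans hv) 2
    have hrr : r ^ 2 ≤ 2 * (ε ^ 2 - x ^ 2) := l2Z_neighbour_sq_le u hu n
    have h1 : ‖u n * conj (u n) - v n * conj (v n)‖ = |x ^ 2 - y ^ 2| := by
      rw [Complex.mul_conj', Complex.mul_conj', ← Complex.ofReal_pow, ← Complex.ofReal_pow,
        ← Complex.ofReal_sub, Complex.norm_real, Real.norm_eq_abs]
    have h2 : ‖2 * (u n * conj (u n) - v n * conj (v n)) * c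
      + (conj c * u n + c * conj (u n)) * (u (n + 1) + u (n - 1))‖
        ≤ 2 * ‖c‖ * (|x ^ 2 - y ^ 2| + x * r) := by
      refine (norm_add_le _ _).trans ?_
      rw [norm_mul, norm_mul, h1, norm_mul (_ + _)]
      have := mul_le_mul_of_nonneg_right (norm_conj_mul_add_le c (u n)) hr
      simp only [Complex.norm_ofNat]
      nlinarith
    have h3 : (|x ^ 2 - y ^ 2| + x * r) ^ 2 ≤ ε ^ 2 * (5 / 2 * y ^ 2 + 10 / 3 * x ^ 2) := by
      have h4 := sq_abs (x ^ 2 - y ^ 2)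
      have h5 := sq_nonneg (3 * |x ^ 2 - y ^ 2| - 2 * (x * r))
      have h6 := mul_le_mul_of_nonneg_left hrr (sq_nonneg x)
      have h7 := mul_le_mul_of_nonneg_left hyε (sq_nonneg y)
      have h8 : 0 ≤ x ^ 2 * y ^ 2 := by positivity
      nlinarith [sq_nonneg (x ^ 2)]
    calc _ ≤ (2 * ‖c‖ * (|x ^ 2 - y ^ 2| + x * r)) ^ 2 :=
          pow_le_pow_left₀ (norm_nonneg _) h2 2
      _ = 4 * ‖c‖ ^ 2 * (|x ^ 2 - y ^ 2| + x * r) ^ 2 := by ring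
      _ ≤ 4 * ‖c‖ ^ 2 * (ε ^ 2 * (5 / 2 * y ^ 2 + 10 / 3 * x ^ 2)) := by gcongr
      _ = _ := by ring
  refine .of_sum_le (by positivity) (fun s => ?_)
  refine (Finset.sum_le_sum (fun n _ => key n)).trans ?_
  rw [← Finset.mul_sum, Finset.sum_add_distrib, ← Finset.mul_sum, ← Finset.mul_sum]
  have hu2 := (l2Z_sum_sq_le u s).trans (pow_le_pow_left₀ (norm_nonneg _) hu 2)
  have hv2 := (l2Z_sum_sq_le v s).trans (pow_le_pow_left₀ (norm_nonneg _) hv 2)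
  calc _ ≤ 4 * ‖c‖ ^ 2 * ε ^ 2 * (25 / 4 * ε ^ 2) := by
        gcongr
        linarith [sq_nonneg ε]
    _ = _ := by ring

/-- The cubic Ablowitz–Ladik term. -/
lemma L2Bdd.cubic_neighbour (u : l2Z) {ε : ℝ} (hu : ‖u‖ ≤ ε) :
    L2Bdd (fun n => u n * conj (u n) * (u (n + 1) + u (n - 1))) (ε ^ 3) := by
  refine (L2Bdd.of_le_mul (u := u) (sq_nonneg ε) (fun n => ?_)).mono
    ((mul_le_mul_of_nonneg_left hu (sq_nonneg ε)).trans_eq (by ring))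
  rw [norm_mul, norm_mul, RCLike.norm_conj]
  have h1 : ‖u n‖ * ‖u (n + 1) + u (n - 1)‖ ≤ ε ^ 2 := by
    have := l2Z_neighbour_sq_le u hu n
    nlinarith [sq_nonneg (3 * ‖u n‖ - 2 * ‖u (n + 1) + u (n - 1)‖), sq_nonneg ε,
      sq_nonneg (‖u n‖ - ‖u (n + 1) + u (n - 1)‖), sq_nonneg ‖u n‖,
      sq_nonneg ‖u (n + 1) + u (n - 1)‖]
  nlinarith [norm_nonneg (u n)]

/-- The `ℓ²` bound on the difference of the two nonlinearities. -/
lemma L2Bdd.F_AL_sub_F_DNLS (u v : l2Z) (c : ℂ) {ε : ℝ} (hε : 0 ≤ ε)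
    (hu : ‖u‖ ≤ ε) (hv : ‖v‖ ≤ ε) :
    L2Bdd (fun n => F_AL ‖c‖ c c u n - F_DNLS ‖c‖ c c v n)
      (3 * ε ^ 3 + 9 * ‖c‖ * ε ^ 2 + 12 * ‖c‖ ^ 2 * ε) := by
  have hlin : ∀ w : l2Z, ‖w‖ ≤ ε → ∀ b : ℂ, ‖b‖ = 2 →
      L2Bdd (fun n => b * (conj c * w n + c * conj (w n)) * c) (4 * ‖c‖ ^ 2 * ε) := by
    intro w hw b hb
    refine (L2Bdd.of_le_mul (u := w) (C := 4 * ‖c‖ ^ 2) (by positivity) (fun n => ?_)).mono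
      (by gcongr)
    rw [norm_mul, norm_mul, hb]
    nlinarith [mul_le_mul_of_nonneg_right (norm_conj_mul_add_le c (w n)) (norm_nonneg c)]
  have hlap : L2Bdd (fun n => c * conj c * (u (n + 1) + u (n + -1) + -2 * u n))
      (4 * ‖c‖ ^ 2 * ε) := by
    have h0 : L2Bdd (fun n => u n) ‖u‖ := ⟨u, fun _ => rfl, le_rfl⟩
    refine ((((L2Bdd.shift u 1).add (L2Bdd.shift u (-1))).add
      (h0.mul_left (-2))).mul_left (c * conj c)).mono ?_
    rw [norm_mul, RCLike.norm_conj, norm_neg, Complex.norm_ofNat]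
    nlinarith [mul_le_mul_of_nonneg_left hu (sq_nonneg ‖c‖)]
  have hcub : L2Bdd (fun n => -2 * (v n * conj (v n)) * v n) (2 * ε ^ 3) := by
    refine (L2Bdd.of_le_mul (u := v) (C := 2 * ε ^ 2) (by positivity) (fun n => ?_)).mono
      ((mul_le_mul_of_nonneg_left hv (by positivity)).trans_eq (by ring))
    simp only [norm_mul, RCLike.norm_conj, norm_neg, Complex.norm_ofNat]
    have := (l2Z_norm_apply_le v n).trans hv
    rw [← sq]
    gcongr
  have hquad : L2Bdd (fun n => -2 * (conj c * v n + c * conj (v n)) * v n)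
      (4 * ‖c‖ * ε ^ 2) := by
    refine (L2Bdd.of_le_mul (u := v) (C := 4 * ‖c‖ * ε) (by positivity) (fun n => ?_)).mono
      ((mul_le_mul_of_nonneg_left hv (by positivity)).trans_eq (by ring))
    rw [norm_mul, norm_mul, norm_neg, Complex.norm_ofNat]
    have h1 := (l2Z_norm_apply_le v n).trans hv
    refine mul_le_mul_of_nonneg_right ?_ (norm_nonneg _)
    calc _ ≤ 2 * (2 * ‖c‖ * ‖v n‖) := by gcongr; exact norm_conj_mul_add_le c (v n)
      _ ≤ 2 * (2 * ‖c‖ * ε) := by gcongr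
      _ = _ := by ring
  obtain ⟨w, hw, hwC⟩ := ((((((L2Bdd.quadratic u v c hu hv).add
    (L2Bdd.cubic_neighbour u hu)).add (hlin u hu 2 (by simp))).add
    (hlin v hv (-2) (by simp))).add hlap).add hcub).add hquad
  refine ⟨w, fun n => ?_, hwC.trans_eq (by ring)⟩
  rw [hw]
  simp only [F_AL, F_DNLS, stepBg, ite_self, ← Complex.mul_conj', map_add, ← sub_eq_add_neg]
  ring

/-- The discrete Schrödinger flow is conservative: `i Δ_d` is skew for the real inner product. -/
lemma l2Z_hasSum_inner_I_discLap (D : l2Z) :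
    HasSum (fun n => inner ℝ (D n) (Complex.I * discLap D n)) 0 := by
  obtain ⟨S, hS, -⟩ := L2Bdd.shift D 1
  have hs : Summable (fun n => inner ℝ (D n) (Complex.I * D (n + 1))) := by
    have h := lp.summable_inner (𝕜 := ℝ) D (Complex.I • S)
    simpa only [lp.coeFn_smul, Pi.smul_apply, hS, smul_eq_mul] using h
  have h1 := hs.hasSum
  have h2 := (Equiv.subRight (1 : ℤ)).hasSum_iff.mpr h1
  have h3 := h1.sub h2
  rw [sub_self] at h3
  refine h3.congr_fun ?_
  intro n
  simp only [Function.comp_apply, Equiv.subRight_apply, sub_add_cancel, discLap,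
    Complex.inner, Complex.mul_re, Complex.mul_im, Complex.conj_re, Complex.conj_im,
    Complex.I_re, Complex.I_im, Complex.add_re, Complex.add_im, Complex.sub_re, Complex.sub_im,
    Complex.re_ofNat, Complex.im_ofNat]
  ring

/-- If the derivative of `D` has radial component at most `α`, then `‖D‖` grows at rate
at most `α`. -/
lemma norm_le_of_inner_deriv_le {E : Type*} [NormedAddCommGroup E] [InnerProductSpace ℝ E]
    {D D' : ℝ → E} {T α : ℝ} (hα : 0 ≤ α)
    (hD : ∀ t ∈ Set.Icc 0 T, HasDerivWithinAt D (D' t) (Set.Icc 0 T) t)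
    (h : ∀ t ∈ Set.Icc 0 T, inner ℝ (D t) (D' t) ≤ α * ‖D t‖) :
    ∀ t ∈ Set.Icc 0 T, ‖D t‖ ≤ ‖D 0‖ + α * t := by
  intro t ht
  refine le_of_forall_pos_le_add (fun δ hδ => ?_)
  have hpos : ∀ s, 0 < ‖D s‖ ^ 2 + δ ^ 2 := fun s => by positivity
  have hg : ∀ s ∈ Set.Icc 0 T, HasDerivWithinAt (fun s => √(‖D s‖ ^ 2 + δ ^ 2))
      (2 * inner ℝ (D s) (D' s) / (2 * √(‖D s‖ ^ 2 + δ ^ 2))) (Set.Icc 0 T) s :=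
    fun s hs => ((hD s hs).norm_sq.add_const _).sqrt (hpos s).ne'
  have hB : ∀ s : ℝ, HasDerivAt (fun s => ‖D 0‖ + δ + α * s) α s := fun s => by
    simpa using ((hasDerivAt_id s).const_mul α).const_add (‖D 0‖ + δ)
  have hmain := image_le_of_deriv_right_le_deriv_boundary
    (f := fun s => √(‖D s‖ ^ 2 + δ ^ 2)) (B := fun s => ‖D 0‖ + δ + α * s)
    (B' := fun _ => α) (fun s hs => (hg s hs).continuousWithinAt)
    (fun s hs => (hg s ⟨hs.1, hs.2.le⟩).mono_of_mem_nhdsWithin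
      (Icc_mem_nhdsGE_of_mem hs))
    (by
      rw [mul_zero, add_zero]
      refine Real.sqrt_le_iff.mpr ⟨by positivity, ?_⟩
      nlinarith [norm_nonneg (D 0)])
    (fun s _ => (hB s).continuousAt.continuousWithinAt) (fun s _ => (hB s).hasDerivWithinAt)
    (fun s hs => by
      have hsq : ‖D s‖ ≤ √(‖D s‖ ^ 2 + δ ^ 2) :=
        Real.le_sqrt_of_sq_le (by nlinarith)
      have := Real.sqrt_pos.mpr (hpos s)
      rw [div_le_iff₀ (by positivity)]
      nlinarith [h s ⟨hs.1, hs.2.le⟩, mul_le_mul_of_nonneg_left hsq hα]) ht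
  have hle : ‖D t‖ ≤ √(‖D t‖ ^ 2 + δ ^ 2) := Real.le_sqrt_of_sq_le (by nlinarith)
  have hmain' : √(‖D t‖ ^ 2 + δ ^ 2) ≤ ‖D 0‖ + δ + α * t := hmain
  linarith

/-- explicit proximity bound `‖U(t) - V(t)‖ ≤ ε³ + α t` with
`α = 3ε³ + 9qε² + 12q²ε`, for a constant background `q_+ = q_-`. -/
theorem dist_explicit_alpha_bound
    (κ q Tc : ℝ) (hκ : 0 < κ) (hq : 0 < q) (qm qp : ℂ) (hqm : ‖qm‖ = q) (hqp : ‖qp‖ = q)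
    (hconst : qp = qm)
    (ε : ℝ) (hε0 : 0 < ε) (hε1 : ε < 1)
    (U V : ℝ → l2Z)
    (hU : IsModALSol κ q qm qp Tc U) (hV : IsModDNLSSol κ q qm qp Tc V)
    (hdist0 : ‖U 0 - V 0‖ ≤ ε ^ 3) (hqε : q ≤ ε)
    (hUb : ∀ t ∈ Set.Icc (0:ℝ) Tc, ‖U t‖ ≤ ε)
    (hVb : ∀ t ∈ Set.Icc (0:ℝ) Tc, ‖V t‖ ≤ ε) :
    ∀ t ∈ Set.Icc (0:ℝ) Tc,
      ‖U t - V t‖ ≤ ε ^ 3 + (3 * ε ^ 3 + 9 * q * ε ^ 2 + 12 * q ^ 2 * ε) * t := by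
  obtain ⟨U', -, hU', hUeq⟩ := hU
  obtain ⟨V', -, hV', hVeq⟩ := hV
  subst hconst
  subst hqm
  have hα : 0 ≤ 3 * ε ^ 3 + 9 * ‖qp‖ * ε ^ 2 + 12 * ‖qp‖ ^ 2 * ε := by positivity
  have hD : ∀ t ∈ Set.Icc 0 Tc,
      HasDerivWithinAt (fun t => U t - V t) (U' t - V' t) (Set.Icc 0 Tc) t :=
    fun t ht => (hU' t ht).sub (hV' t ht)
  intro t ht
  refine (norm_le_of_inner_deriv_le hα hD (fun s hs => ?_) t ht).trans
    (add_le_add_left hdist0 _)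
  obtain ⟨w, hw, hwα⟩ := L2Bdd.F_AL_sub_F_DNLS (U s) (V s) qp hε0.le (hUb s hs) (hVb s hs)
  have hderiv : ∀ n, (U' s - V' s) n
      = κ • (Complex.I * discLap (⇑(U s - V s)) n) + (Complex.I • w) n := by
    intro n
    have h1 := hUeq s hs n
    have h2 := hVeq s hs n
    simp only [lp.coeFn_sub, lp.coeFn_smul, Pi.sub_apply, Pi.smul_apply, smul_eq_mul, hw,
      Complex.real_smul, discLap] at h1 h2 ⊢
    linear_combination (-Complex.I) * (h1 - h2) + (U' s n - V' s n) * Complex.I_mul_I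
  have h0 := (l2Z_hasSum_inner_I_discLap (U s - V s)).mul_left κ
  have h1 := lp.hasSum_inner (𝕜 := ℝ) (U s - V s) (Complex.I • w)
  have h2 := lp.hasSum_inner (𝕜 := ℝ) (U s - V s) (U' s - V' s)
  have h3 : inner ℝ (U s - V s) (U' s - V' s) = inner ℝ (U s - V s) (Complex.I • w) := by
    refine h2.unique ?_
    have h4 := h0.add h1
    rw [mul_zero, zero_add] at h4
    simpa only [hderiv, inner_add_right, real_inner_smul_right] using h4
  rw [h3]
  refine (real_inner_le_norm _ _).trans ?_
  rw [norm_smul, Complex.norm_I, one_mul, mul_comm]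
  gcongr
end
end

section
/- Let ψ be a continuously differentiable global solution of the periodic Ablowitz–Ladik equation. Then for all t ≥ 0, ‖ψ(t)‖_{ℓ²_per}² ≤ exp(P_AL(0)) − 1, where P_AL(0) = Σ_{n=0}^{N−1} log(1 + |ψ_n(0)|²). -/
noncomputable section

/-- The `ℓ²_per` norm `(Σ_{n=0}^{N-1} |u n|²)^{1/2}` of an `N`-periodic sequence. -/
def perNorm (N : ℕ) (u : ℤ → ℂ) : ℝ := Real.sqrt (∑ n ∈ Finset.range N, ‖u (n : ℤ)‖ ^ 2)

/-- `ψ` is a continuously differentiable family of `N`-periodic sequences solving the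
periodic Ablowitz–Ladik equation
`i ψ̇_n + (Δ_d ψ)_n - 2q²ψ_n + |ψ_n|²(ψ_{n+1} + ψ_{n-1}) = 0` on `[0,∞)`. -/
def IsPerALSol (N : ℕ) (q : ℝ) (ψ : ℝ → ℤ → ℂ) : Prop :=
  ∃ ψ' : ℝ → ℤ → ℂ,
    (∀ n : ℤ, ContinuousOn (fun t => ψ' t n) (Set.Ici 0)) ∧
    (∀ t ∈ Set.Ici (0:ℝ), ∀ n : ℤ, ψ t (n + N) = ψ t n) ∧
    (∀ t ∈ Set.Ici (0:ℝ), ∀ n : ℤ,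
      HasDerivWithinAt (fun s => ψ s n) (ψ' t n) (Set.Ici 0) t) ∧
    (∀ t ∈ Set.Ici (0:ℝ), ∀ n : ℤ,
      Complex.I * ψ' t n + discLap (ψ t) n - 2 * (q : ℂ) ^ 2 * ψ t n
        + (‖ψ t n‖ : ℂ) ^ 2 * (ψ t (n + 1) + ψ t (n - 1)) = 0)

/-- `φ` is a continuously differentiable family of `N`-periodic sequences solving the
periodic DNLS equation `i φ̇_n + κ(Δ_d φ)_n + 2(|φ_n|² - q²)φ_n = 0` on `[0,∞)`. -/
def IsPerDNLSSol (N : ℕ) (κ q : ℝ) (φ : ℝ → ℤ → ℂ) : Prop :=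
  ∃ φ' : ℝ → ℤ → ℂ,
    (∀ n : ℤ, ContinuousOn (fun t => φ' t n) (Set.Ici 0)) ∧
    (∀ t ∈ Set.Ici (0:ℝ), ∀ n : ℤ, φ t (n + N) = φ t n) ∧
    (∀ t ∈ Set.Ici (0:ℝ), ∀ n : ℤ,
      HasDerivWithinAt (fun s => φ s n) (φ' t n) (Set.Ici 0) t) ∧
    (∀ t ∈ Set.Ici (0:ℝ), ∀ n : ℤ,
      Complex.I * φ' t n + (κ : ℂ) * discLap (φ t) n
        + 2 * ((‖φ t n‖ : ℂ) ^ 2 - (q : ℂ) ^ 2) * φ t n = 0)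

/-- Flux form of the local conservation law: if `u` evolves by the Ablowitz–Ladik equation, with
neighbours `v` and `w`, then `log (1 + |u|²)` changes by a difference of currents `Im (ū v)`. -/
theorem AL_hasDerivWithinAt_log {q : ℝ} {u : ℝ → ℂ} {u' v w : ℂ} {s : Set ℝ} {t : ℝ}
    (hu : HasDerivWithinAt u u' s t)
    (heq : Complex.I * u' + (v - 2 * u t + w) - 2 * (q : ℂ) ^ 2 * u t
      + (‖u t‖ : ℂ) ^ 2 * (v + w) = 0) :
    HasDerivWithinAt (fun x => Real.log (1 + ‖u x‖ ^ 2))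
      (2 * (star w * u t).im - 2 * (star (u t) * v).im) s t := by
  have hpos : 1 + ‖u t‖ ^ 2 ≠ 0 := by positivity
  refine ((hu.norm_sq.const_add 1).log hpos).congr_deriv ?_
  rw [div_eq_iff hpos]
  have hre := congrArg Complex.re heq
  have him := congrArg Complex.im heq
  rw [← Complex.ofReal_pow, ← Complex.ofReal_pow] at hre him
  simp only [Complex.add_re, Complex.add_im, Complex.sub_re, Complex.sub_im, Complex.mul_re,
    Complex.mul_im, Complex.I_re, Complex.I_im, Complex.ofReal_re, Complex.ofReal_im,
    Complex.re_ofNat, Complex.im_ofNat, Complex.zero_re, Complex.zero_im] at hre him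
  simp only [Complex.inner, Complex.mul_re, Complex.mul_im, Complex.star_def, Complex.conj_re,
    Complex.conj_im]
  linear_combination 2 * (u t).re * him - 2 * (u t).im * hre

/-- The quantity `Σ log (1 + |ψ_n|²)` is conserved by the periodic Ablowitz–Ladik flow. -/
theorem IsPerALSol.sum_log_eq {N : ℕ} {q : ℝ} {ψ : ℝ → ℤ → ℂ} (hψ : IsPerALSol N q ψ)
    {t : ℝ} (ht : 0 ≤ t) :
    ∑ n ∈ Finset.range N, Real.log (1 + ‖ψ t (n : ℤ)‖ ^ 2)
      = ∑ n ∈ Finset.range N, Real.log (1 + ‖ψ 0 (n : ℤ)‖ ^ 2) := by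
  obtain ⟨ψ', -, hper, hderiv, heq⟩ := hψ
  have key : ∀ x ∈ Set.Ici (0 : ℝ), HasDerivWithinAt
      (fun x => ∑ n ∈ Finset.range N, Real.log (1 + ‖ψ x (n : ℤ)‖ ^ 2)) 0 (Set.Ici 0) x := by
    intro x hx
    refine (HasDerivWithinAt.fun_sum fun (n : ℕ) _ =>
      AL_hasDerivWithinAt_log (hderiv x hx n) (heq x hx n)).congr_deriv ?_
    have htel := Finset.sum_range_sub'
      (fun n : ℕ => 2 * (star (ψ x ((n : ℤ) - 1)) * ψ x n).im) N
    have h₁ : ψ x ((N : ℤ) - 1) = ψ x (-1) := by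
      rw [← hper x hx (-1), neg_add_eq_sub]
    have h₂ : ψ x (N : ℤ) = ψ x 0 := by
      rw [← hper x hx 0, zero_add]
    simpa [h₁, h₂] using htel
  refine constant_of_has_deriv_right_zero (a := 0) (b := t)
    (fun x hx => ((key x hx.1).continuousWithinAt).mono fun y hy => hy.1)
    (fun x hx => (key x hx.1).mono (Set.Ici_subset_Ici.2 hx.1)) t ⟨ht, le_rfl⟩

/-- The product `∏ (1 + f i)` of nonnegative `f i` dominates its first-order part. -/
theorem one_add_sum_le_prod_one_add {ι : Type*} (s : Finset ι) {f : ι → ℝ}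
    (hf : ∀ i ∈ s, 0 ≤ f i) : 1 + ∑ i ∈ s, f i ≤ ∏ i ∈ s, (1 + f i) := by
  classical
  induction s using Finset.induction_on with
  | empty => simp
  | insert a s ha ih =>
    rw [Finset.sum_insert ha, Finset.prod_insert ha]
    have hs : ∀ i ∈ s, 0 ≤ f i := fun i hi => hf i (Finset.mem_insert_of_mem hi)
    have ha₀ : 0 ≤ f a := hf a (Finset.mem_insert_self a s)
    nlinarith [ih hs, mul_nonneg ha₀ (Finset.sum_nonneg hs)]

/-- uniform `ℓ²_per` bound for solutions of the periodic Ablowitz–Ladik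
equation: `‖ψ(t)‖² ≤ exp(P_AL(0)) - 1`. -/
theorem periodic_AL_uniform_bound
    (N : ℕ) (hN : 1 ≤ N) (q : ℝ) (hq : 0 < q)
    (ψ : ℝ → ℤ → ℂ) (hψ : IsPerALSol N q ψ) :
    ∀ t ∈ Set.Ici (0:ℝ),
      perNorm N (ψ t) ^ 2
        ≤ Real.exp (∑ n ∈ Finset.range N, Real.log (1 + ‖ψ 0 (n : ℤ)‖ ^ 2)) - 1 := by
  intro t ht
  have hexp : Real.exp (∑ n ∈ Finset.range N, Real.log (1 + ‖ψ t (n : ℤ)‖ ^ 2))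
      = ∏ n ∈ Finset.range N, (1 + ‖ψ t (n : ℤ)‖ ^ 2) := by
    rw [Real.exp_sum]
    exact Finset.prod_congr rfl fun n _ => Real.exp_log (by positivity)
  rw [perNorm, Real.sq_sqrt (by positivity), ← hψ.sum_log_eq ht, hexp, le_sub_iff_add_le']
  exact one_add_sum_le_prod_one_add _ fun n _ => by positivity
end
end

section
/- Let 0 < ε < 1 and fix positive constants C₁, C₂. Let ψ and φ be continuously differentiable global solutions of the periodic Ablowitz–Ladik equation and the periodic discrete nonlinear Schrödinger equation, respectively, with ‖ψ(0)‖_{ℓ²_per} ≤ C₁ε and ‖φ(0)‖_{ℓ²_per} ≤ C₂ε. Then there exists a constant Ĉ > 0, depending only on C₁ and C₂ and independent of t, such that ‖ψ(t) − φ(t)‖_{ℓ²_per} ≤ Ĉ ε for all t ≥ 0. -/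
noncomputable section

/-- Conservation law for lattice equations `u̇_n = i (g(|u_n|²)(u_{n+1} + u_{n-1}) + r u_n)` with
`r` real: if `G' = 1 / g`, then `Σ_n G(|u_n|²)` over a period is constant in time. -/
theorem sum_comp_normSq_eq_of_lattice_eq {N : ℕ} {u u' : ℝ → ℤ → ℂ} {g G : ℝ → ℝ}
    {r : ℝ → ℤ → ℝ}
    (hg : ∀ x, 0 ≤ x → g x ≠ 0) (hG : ∀ x, 0 ≤ x → HasDerivAt G (g x)⁻¹ x)
    (hper : ∀ t ∈ Set.Ici (0 : ℝ), ∀ n : ℤ, u t (n + N) = u t n)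
    (hder : ∀ t ∈ Set.Ici (0 : ℝ), ∀ n : ℤ,
      HasDerivWithinAt (fun s => u s n) (u' t n) (Set.Ici 0) t)
    (heq : ∀ t ∈ Set.Ici (0 : ℝ), ∀ n : ℤ, u' t n =
      Complex.I * ((g (‖u t n‖ ^ 2) : ℂ) * (u t (n + 1) + u t (n - 1)) + (r t n : ℂ) * u t n))
    {t : ℝ} (ht : 0 ≤ t) :
    ∑ n ∈ Finset.range N, G (‖u t (n : ℤ)‖ ^ 2) =
      ∑ n ∈ Finset.range N, G (‖u 0 (n : ℤ)‖ ^ 2) := by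
  have key : ∀ s ∈ Set.Ici (0 : ℝ), HasDerivWithinAt
      (fun s => ∑ n ∈ Finset.range N, G (‖u s (n : ℤ)‖ ^ 2)) 0 (Set.Ici 0) s := by
    intro s hs
    let J : ℤ → ℝ := fun n => 2 * ((u s (n - 1)).re * (u s n).im - (u s (n - 1)).im * (u s n).re)
    have hterm : ∀ n : ℤ, HasDerivWithinAt (fun s => G (‖u s n‖ ^ 2)) (J n - J (n + 1))
        (Set.Ici 0) s := by
      intro n
      have h := (hG _ (sq_nonneg ‖u s n‖)).comp_hasDerivWithinAt s (hder s hs n).norm_sq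
      refine h.congr_deriv ?_
      have hne := hg _ (sq_nonneg ‖u s n‖)
      rw [heq s hs n, Complex.inner]
      generalize g (‖u s n‖ ^ 2) = w at hne ⊢
      simp only [J, add_sub_cancel_right, Complex.mul_re, Complex.mul_im, Complex.add_re,
        Complex.add_im, Complex.I_re, Complex.I_im, Complex.ofReal_re, Complex.ofReal_im,
        Complex.conj_re, Complex.conj_im]
      field_simp
      ring
    refine (HasDerivWithinAt.fun_sum (u := Finset.range N)
      fun n _ => hterm (n : ℤ)).congr_deriv ?_
    have htel := Finset.sum_range_sub' (fun n : ℕ => J n) N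
    push_cast at htel
    rw [htel]
    have h1 := hper s hs (-1)
    have h0 := hper s hs 0
    simp only [J, sub_eq_add_neg, zero_add] at h0 h1 ⊢
    rw [add_comm (N : ℤ) (-1), h1, h0, add_neg_cancel]
  refine constant_of_has_deriv_right_zero (a := 0) (b := t)
    (fun s hs => (key s hs.1).continuousWithinAt.mono Set.Icc_subset_Ici_self)
    (fun s hs => (key s hs.1).mono (Set.Ici_subset_Ici.2 hs.1)) t ⟨ht, le_rfl⟩

theorem sum_le_exp_sum_log_one_add_sub_one {ι : Type*} (s : Finset ι) {x : ι → ℝ}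
    (hx : ∀ i ∈ s, 0 ≤ x i) :
    ∑ i ∈ s, x i ≤ Real.exp (∑ i ∈ s, Real.log (1 + x i)) - 1 := by
  have h : Real.exp (∑ i ∈ s, Real.log (1 + x i)) = ∏ i ∈ s, (1 + x i) := by
    rw [Real.exp_sum]
    exact Finset.prod_congr rfl fun i hi => Real.exp_log (by linarith [hx i hi])
  have h' : 1 + ∑ i ∈ s, x i ≤ ∏ i ∈ s, (1 + x i) := by
    classical
    clear h
    induction s using Finset.induction_on with
    | empty => simp
    | insert a s ha ih =>
      have ih := ih fun i hi => hx i (Finset.mem_insert_of_mem hi)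
      have hsum : 0 ≤ ∑ i ∈ s, x i :=
        Finset.sum_nonneg fun i hi => hx i (Finset.mem_insert_of_mem hi)
      have hxa := hx a (Finset.mem_insert_self a s)
      rw [Finset.sum_insert ha, Finset.prod_insert ha]
      nlinarith
  linarith

theorem exp_sub_one_le_mul_exp (x : ℝ) : Real.exp x - 1 ≤ x * Real.exp x := by
  have h : (1 - x) * Real.exp x ≤ Real.exp (-x) * Real.exp x :=
    mul_le_mul_of_nonneg_right (Real.one_sub_le_exp_neg x) (Real.exp_pos x).le
  rw [← Real.exp_add, neg_add_cancel, Real.exp_zero] at h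
  linarith

theorem perNorm_sq (N : ℕ) (u : ℤ → ℂ) :
    perNorm N u ^ 2 = ∑ n ∈ Finset.range N, ‖u (n : ℤ)‖ ^ 2 :=
  Real.sq_sqrt (by positivity)

theorem perNorm_nonneg (N : ℕ) (u : ℤ → ℂ) : 0 ≤ perNorm N u := Real.sqrt_nonneg _

theorem perNorm_sub_sq_le (N : ℕ) (u v : ℤ → ℂ) :
    perNorm N (fun n => u n - v n) ^ 2 ≤ 2 * perNorm N u ^ 2 + 2 * perNorm N v ^ 2 := by
  simp only [perNorm_sq, Finset.mul_sum, ← Finset.sum_add_distrib]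
  refine Finset.sum_le_sum fun n _ => ?_
  have h := pow_le_pow_left₀ (norm_nonneg _) (norm_sub_le (u n) (v n)) 2
  nlinarith [sq_nonneg (‖u n‖ - ‖v n‖)]

/-- `ℓ²` bound for the periodic Ablowitz–Ladik flow, from conservation of `Σ log (1 + |ψ_n|²)`. -/
theorem IsPerALSol.perNorm_sq_le {N : ℕ} {q : ℝ} {ψ : ℝ → ℤ → ℂ} (h : IsPerALSol N q ψ)
    {t : ℝ} (ht : 0 ≤ t) :
    perNorm N (ψ t) ^ 2 ≤ perNorm N (ψ 0) ^ 2 * Real.exp (perNorm N (ψ 0) ^ 2) := by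
  obtain ⟨ψ', -, hper, hder, heq⟩ := h
  have hcons := sum_comp_normSq_eq_of_lattice_eq (g := fun x => 1 + x)
    (G := fun x => Real.log (1 + x)) (r := fun _ _ => -2 - 2 * q ^ 2)
    (fun x hx => by positivity)
    (fun x hx => by
      simpa using ((hasDerivAt_id x).const_add 1).log (by simp only [id]; positivity))
    hper hder
    (fun s hs n => by
      have h := heq s hs n
      unfold discLap at h
      push_cast
      linear_combination (-Complex.I) * h + ψ' s n * Complex.I_sq) ht
  have hlog : ∑ n ∈ Finset.range N, Real.log (1 + ‖ψ 0 (n : ℤ)‖ ^ 2) ≤ perNorm N (ψ 0) ^ 2 := by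
    rw [perNorm_sq]
    refine Finset.sum_le_sum fun n _ => ?_
    have := Real.log_le_sub_one_of_pos (x := 1 + ‖ψ 0 (n : ℤ)‖ ^ 2) (by positivity)
    linarith
  calc perNorm N (ψ t) ^ 2
      ≤ Real.exp (∑ n ∈ Finset.range N, Real.log (1 + ‖ψ t (n : ℤ)‖ ^ 2)) - 1 := by
        rw [perNorm_sq]
        exact sum_le_exp_sum_log_one_add_sub_one _ fun _ _ => by positivity
    _ ≤ Real.exp (perNorm N (ψ 0) ^ 2) - 1 := by
        rw [hcons]
        gcongr
    _ ≤ _ := exp_sub_one_le_mul_exp _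

/-- The periodic DNLS flow preserves the `ℓ²` norm. -/
theorem IsPerDNLSSol.perNorm_sq_eq {N : ℕ} {q : ℝ} {φ : ℝ → ℤ → ℂ} (h : IsPerDNLSSol N 1 q φ)
    {t : ℝ} (ht : 0 ≤ t) : perNorm N (φ t) ^ 2 = perNorm N (φ 0) ^ 2 := by
  obtain ⟨φ', -, hper, hder, heq⟩ := h
  rw [perNorm_sq, perNorm_sq]
  exact sum_comp_normSq_eq_of_lattice_eq (g := fun _ => 1) (G := fun x => x)
    (r := fun s n => -2 + 2 * (‖φ s n‖ ^ 2 - q ^ 2))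
    (fun x _ => one_ne_zero) (fun x _ => by simpa using hasDerivAt_id' x) hper hder
    (fun s hs n => by
      have h := heq s hs n
      unfold discLap at h
      push_cast at h ⊢
      linear_combination (-Complex.I) * h + φ' s n * Complex.I_sq) ht

/-- uniform-in-time `O(ε)` bound for the `ℓ²_per` distance of periodic AL
and DNLS solutions; the constant `Chat` depends only on `C₁` and `C₂`. -/
theorem periodic_dist_uniform_bound
    (C₁ C₂ : ℝ) (hC₁ : 0 < C₁) (hC₂ : 0 < C₂) :
    ∃ Chat : ℝ, 0 < Chat ∧
      ∀ (N : ℕ) (q ε : ℝ) (ψ φ : ℝ → ℤ → ℂ),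
        1 ≤ N → 0 < q → 0 < ε → ε < 1 →
        IsPerALSol N q ψ → IsPerDNLSSol N 1 q φ →
        perNorm N (ψ 0) ≤ C₁ * ε → perNorm N (φ 0) ≤ C₂ * ε →
        ∀ t ∈ Set.Ici (0:ℝ),
          perNorm N (fun n => ψ t n - φ t n) ≤ Chat * ε := by
  refine ⟨Real.sqrt (2 * (C₁ ^ 2 * Real.exp (C₁ ^ 2)) + 2 * C₂ ^ 2), by positivity, ?_⟩
  intro N q ε ψ φ _ _ hε hε1 hψ hφ hψ0 hφ0 t ht
  refine (sq_le_sq₀ (perNorm_nonneg _ _) (by positivity)).1 ?_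
  rw [mul_pow, Real.sq_sqrt (by positivity)]
  have hψ0' : perNorm N (ψ 0) ^ 2 ≤ C₁ ^ 2 * ε ^ 2 := by
    rw [← mul_pow]
    exact pow_le_pow_left₀ (perNorm_nonneg _ _) hψ0 2
  have hφ0' : perNorm N (φ 0) ^ 2 ≤ C₂ ^ 2 * ε ^ 2 := by
    rw [← mul_pow]
    exact pow_le_pow_left₀ (perNorm_nonneg _ _) hφ0 2
  have hle : C₁ ^ 2 * ε ^ 2 ≤ C₁ ^ 2 :=
    mul_le_of_le_one_right (sq_nonneg _) (pow_le_one₀ hε.le hε1.le)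
  have hψt : perNorm N (ψ t) ^ 2 ≤ C₁ ^ 2 * ε ^ 2 * Real.exp (C₁ ^ 2) :=
    (hψ.perNorm_sq_le ht).trans (mul_le_mul hψ0'
      (Real.exp_le_exp.2 (hψ0'.trans hle)) (Real.exp_pos _).le (by positivity))
  have hφt := hφ.perNorm_sq_eq ht
  linarith [perNorm_sub_sq_le N (ψ t) (φ t)]
end
end

section
/- Fix q > 0 and ω_b > 0, and set θ = −arsinh(ω_b/(2q²)), m = (1 + q²)/q², r = arcosh((cosh θ + m − 1)/m), and G = −ω_b/(2q² √m · sinh r). Assume that cos(ω_b t) + G cosh(r n) ≠ 0 for all n ∈ ℤ and all t ∈ ℝ. Then the Kuznetsov–Ma profile ψ_n(t) = q · (cos(ω_b t + iθ) + G cosh(r n)) / (cos(ω_b t) + G cosh(r n)) is, for every n ∈ ℤ, differentiable in t and satisfies the focusing Ablowitz–Ladik equation on the background q: i ∂_t ψ_n(t) + ψ_{n+1}(t) − 2ψ_n(t) + ψ_{n−1}(t) − 2q² ψ_n(t) + |ψ_n(t)|² (ψ_{n+1}(t) + ψ_{n−1}(t)) = 0 for all n ∈ ℤ and t ∈ ℝ.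 -/
noncomputable section

/-- Real inverse hyperbolic cosine, `arcosh x = log (x + √(x² - 1))`. -/
def arcosh (x : ℝ) : ℝ := Real.log (x + Real.sqrt (x ^ 2 - 1))

/-- Kuznetsov–Ma parameter `θ = -arsinh(ω_b/(2q²))`. -/
def θKM (q ω : ℝ) : ℝ := -Real.arsinh (ω / (2 * q ^ 2))

/-- Kuznetsov–Ma parameter `m = (1 + q²)/q²`. -/
def mKM (q : ℝ) : ℝ := (1 + q ^ 2) / q ^ 2

/-- Kuznetsov–Ma parameter `r = arcosh((cosh θ + m - 1)/m)`. -/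
def rKM (q ω : ℝ) : ℝ := arcosh ((Real.cosh (θKM q ω) + mKM q - 1) / mKM q)

/-- Kuznetsov–Ma parameter `G = -ω_b/(2q²√m sinh r)`. -/
def GKM (q ω : ℝ) : ℝ := -ω / (2 * q ^ 2 * Real.sqrt (mKM q) * Real.sinh (rKM q ω))

/-- The Kuznetsov–Ma breather profile
`ψ_n(t) = q (cos(ω_b t + iθ) + G cosh(rn)) / (cos(ω_b t) + G cosh(rn))`. -/
def ψKM (q ω : ℝ) (n : ℤ) (t : ℝ) : ℂ :=
  (q : ℂ) * (Complex.cos ((ω * t : ℝ) + Complex.I * (θKM q ω : ℝ))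
      + ((GKM q ω * Real.cosh (rKM q ω * n) : ℝ) : ℂ))
    / ((Real.cos (ω * t) + GKM q ω * Real.cosh (rKM q ω * n) : ℝ) : ℂ)

theorem cosh_arcosh_of_one_le {x : ℝ} (hx : 1 ≤ x) : Real.cosh (arcosh x) = x := by
  have h : 0 ≤ x ^ 2 - 1 := by nlinarith
  have hp : 0 < x + Real.sqrt (x ^ 2 - 1) := by positivity
  rw [arcosh, Real.cosh_log hp]
  field_simp
  linear_combination Real.sq_sqrt h

/-- The lattice equation for a profile `q N / D`, with the time derivative of `N / D` and the
neighbouring sites inserted, as an algebraic identity. -/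
theorem ablowitzLadik_identity {q c s C S H K L : ℂ}
    (hcs : c ^ 2 + s ^ 2 = 1) (hCS : C ^ 2 - S ^ 2 = 1)
    (hK : (1 + q ^ 2) * (K - 1) = q ^ 2 * (C - 1))
    (hL : (1 + q ^ 2) * L ^ 2 = (1 + q ^ 2) * (H ^ 2 * (K ^ 2 - 1)) - q ^ 2 * S ^ 2)
    (hD : c + H ≠ 0) (hDp : c + (H * K + L) ≠ 0) (hDm : c + (H * K - L) ≠ 0) :
    Complex.I * (q * ((-2 * q ^ 2 * S) * (-s * C - Complex.I * c * S) * (c + H)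
          - (c * C - Complex.I * s * S + H) * ((-2 * q ^ 2 * S) * (-s))) / (c + H) ^ 2)
      + q * (c * C - Complex.I * s * S + (H * K + L)) / (c + (H * K + L))
      - 2 * (q * (c * C - Complex.I * s * S + H) / (c + H))
      + q * (c * C - Complex.I * s * S + (H * K - L)) / (c + (H * K - L))
      - 2 * q ^ 2 * (q * (c * C - Complex.I * s * S + H) / (c + H))
      + q ^ 2 * ((c * C + H) ^ 2 + (s * S) ^ 2) / (c + H) ^ 2
        * (q * (c * C - Complex.I * s * S + (H * K + L)) / (c + (H * K + L))
          + q * (c * C - Complex.I * s * S + (H * K - L)) / (c + (H * K - L))) = 0 := by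
  have hprod : q ^ 2 * ((c * C + H) ^ 2 + (s * S) ^ 2) / (c + H) ^ 2
      = (1 + q ^ 2) * ((c + (H * K + L)) * (c + (H * K - L))) / (c + H) ^ 2 - 1 := by
    field_simp
    linear_combination q ^ 2 * S ^ 2 * hcs + q ^ 2 * c ^ 2 * hCS + hL - 2 * c * H * hK
  have hsum : q * (c * C - Complex.I * s * S + (H * K + L)) / (c + (H * K + L))
      + q * (c * C - Complex.I * s * S + (H * K - L)) / (c + (H * K - L))
      = 2 * q * ((c + (H * K + L)) * (c + (H * K - L))
          + (c * (C - 1) - Complex.I * s * S) * (c + H * K))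
        / ((c + (H * K + L)) * (c + (H * K - L))) := by
    field_simp
    ring
  have hmul : (1 + q ^ 2) * ((c + (H * K + L)) * (c + (H * K - L))) / (c + H) ^ 2
      * (2 * q * ((c + (H * K + L)) * (c + (H * K - L))
          + (c * (C - 1) - Complex.I * s * S) * (c + H * K))
        / ((c + (H * K + L)) * (c + (H * K - L))))
      = 2 * q * (1 + q ^ 2) * ((c + (H * K + L)) * (c + (H * K - L))
          + (c * (C - 1) - Complex.I * s * S) * (c + H * K)) / (c + H) ^ 2 := by
    field_simp
  have hpoly : Complex.I * ((-2 * q ^ 2 * S) * (-s * C - Complex.I * c * S) * (c + H)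
          - (c * C - Complex.I * s * S + H) * ((-2 * q ^ 2 * S) * (-s)))
      - 2 * (1 + q ^ 2) * ((c * C - Complex.I * s * S + H) * (c + H))
      + 2 * (1 + q ^ 2) * ((c + (H * K + L)) * (c + (H * K - L))
          + (c * (C - 1) - Complex.I * s * S) * (c + H * K)) = 0 := by
    linear_combination -2 * hL + 2 * H * (2 * c + c * (C - 1) - Complex.I * s * S) * hK
      - 2 * q ^ 2 * S ^ 2 * hcs + 2 * q ^ 2 * c * H * hCS
      + 2 * q ^ 2 * S ^ 2 * (c * (c + H) + s ^ 2) * Complex.I_sq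
  have hrest : Complex.I * (q * ((-2 * q ^ 2 * S) * (-s * C - Complex.I * c * S) * (c + H)
          - (c * C - Complex.I * s * S + H) * ((-2 * q ^ 2 * S) * (-s))) / (c + H) ^ 2)
      - 2 * (1 + q ^ 2) * (q * (c * C - Complex.I * s * S + H) / (c + H))
      + 2 * q * (1 + q ^ 2) * ((c + (H * K + L)) * (c + (H * K - L))
          + (c * (C - 1) - Complex.I * s * S) * (c + H * K)) / (c + H) ^ 2 = 0 := by
    field_simp
    linear_combination q * hpoly
  rw [hprod]
  linear_combination hrest + hmul
    + (1 + q ^ 2) * ((c + (H * K + L)) * (c + (H * K - L))) / (c + H) ^ 2 * hsum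

theorem sinh_θKM (q ω : ℝ) : Real.sinh (θKM q ω) = -(ω / (2 * q ^ 2)) := by
  rw [θKM, Real.sinh_neg, Real.sinh_arsinh]

theorem mKM_pos {q : ℝ} (hq : 0 < q) : 0 < mKM q := by
  unfold mKM
  positivity

theorem one_lt_cosh_θKM {q ω : ℝ} (hq : 0 < q) (hω : 0 < ω) : 1 < Real.cosh (θKM q ω) := by
  rw [Real.one_lt_cosh]
  intro h
  have := sinh_θKM q ω
  rw [h, Real.sinh_zero] at this
  have : 0 < ω / (2 * q ^ 2) := by positivity
  linarith

theorem cosh_rKM {q ω : ℝ} (hq : 0 < q) :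
    Real.cosh (rKM q ω) = (Real.cosh (θKM q ω) + mKM q - 1) / mKM q := by
  refine cosh_arcosh_of_one_le ?_
  rw [one_le_div (mKM_pos hq)]
  linarith [Real.one_le_cosh (θKM q ω)]

theorem sinh_rKM_ne_zero {q ω : ℝ} (hq : 0 < q) (hω : 0 < ω) : Real.sinh (rKM q ω) ≠ 0 := by
  have h : 1 < Real.cosh (rKM q ω) := by
    rw [cosh_rKM hq, one_lt_div (mKM_pos hq)]
    linarith [one_lt_cosh_θKM hq hω]
  rw [Real.one_lt_cosh] at h
  rwa [Ne, Real.sinh_eq_zero]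

theorem GKM_sq_mul_sinh_sq {q ω : ℝ} (hq : 0 < q) (hω : 0 < ω) :
    (1 + q ^ 2) * (GKM q ω ^ 2 * Real.sinh (rKM q ω) ^ 2)
      = q ^ 2 * Real.sinh (θKM q ω) ^ 2 := by
  have hs := sinh_rKM_ne_zero hq hω
  rw [sinh_θKM, GKM, div_pow, mul_pow, mul_pow _ (Real.sqrt _), Real.sq_sqrt (mKM_pos hq).le, mKM]
  field_simp

theorem ψKM_eq (q ω : ℝ) (n : ℤ) (t : ℝ) :
    ψKM q ω n t = (q : ℂ) * (Real.cos (ω * t) * Real.cosh (θKM q ω)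
        - Complex.I * Real.sin (ω * t) * Real.sinh (θKM q ω)
        + (GKM q ω * Real.cosh (rKM q ω * n) : ℝ))
      / (Real.cos (ω * t) + (GKM q ω * Real.cosh (rKM q ω * n) : ℝ)) := by
  rw [ψKM, mul_comm Complex.I, Complex.cos_add, Complex.cos_mul_I, Complex.sin_mul_I]
  push_cast
  ring

theorem norm_ψKM_sq (q ω : ℝ) (n : ℤ) (t : ℝ) :
    (‖ψKM q ω n t‖ : ℂ) ^ 2 = (q : ℂ) ^ 2
      * ((Real.cos (ω * t) * Real.cosh (θKM q ω) + (GKM q ω * Real.cosh (rKM q ω * n) : ℝ)) ^ 2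
        + (Real.sin (ω * t) * Real.sinh (θKM q ω)) ^ 2)
      / (Real.cos (ω * t) + (GKM q ω * Real.cosh (rKM q ω * n) : ℝ)) ^ 2 := by
  rw [← Complex.mul_conj', ψKM_eq]
  simp only [map_div₀, map_mul, map_add, map_sub, Complex.conj_ofReal, Complex.conj_I]
  rw [div_mul_div_comm, ← sq]
  congr 1
  linear_combination -(q : ℂ) ^ 2 * (Real.sin (ω * t) * Real.sinh (θKM q ω)) ^ 2 * Complex.I_sq

theorem hasDerivAt_ψKM {q ω : ℝ} {n : ℤ} {t : ℝ}
    (hD : (Real.cos (ω * t) : ℂ) + (GKM q ω * Real.cosh (rKM q ω * n) : ℝ) ≠ 0) :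
    HasDerivAt (fun s => ψKM q ω n s)
      ((q : ℂ) * (ω * (-Real.sin (ω * t) * Real.cosh (θKM q ω)
            - Complex.I * Real.cos (ω * t) * Real.sinh (θKM q ω))
          * (Real.cos (ω * t) + (GKM q ω * Real.cosh (rKM q ω * n) : ℝ))
        - (Real.cos (ω * t) * Real.cosh (θKM q ω)
            - Complex.I * Real.sin (ω * t) * Real.sinh (θKM q ω)
            + (GKM q ω * Real.cosh (rKM q ω * n) : ℝ)) * (ω * (-Real.sin (ω * t))))
      / (Real.cos (ω * t) + (GKM q ω * Real.cosh (rKM q ω * n) : ℝ)) ^ 2) t := by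
  have hlin : HasDerivAt (fun x : ℝ => ω * x) ω t := by
    simpa using (hasDerivAt_id t).const_mul ω
  have hcos := hlin.cos.ofReal_comp
  have hsin := hlin.sin.ofReal_comp
  have hnum := (((hcos.mul_const (Real.cosh (θKM q ω) : ℂ)).sub
    ((hsin.const_mul Complex.I).mul_const (Real.sinh (θKM q ω) : ℂ))).add_const
      ((GKM q ω * Real.cosh (rKM q ω * n) : ℝ) : ℂ)).const_mul (q : ℂ)
  have hquot := hnum.div (hcos.add_const ((GKM q ω * Real.cosh (rKM q ω * n) : ℝ) : ℂ)) hD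
  simp only [ψKM_eq]
  refine hquot.congr_deriv ?_
  simp only [Pi.sub_apply]
  push_cast
  congr 1
  ring

/-- the Kuznetsov–Ma profile solves the focusing Ablowitz–Ladik lattice
on the background `q`, provided its denominator never vanishes. -/
theorem KM_solves_AL
    (q ω : ℝ) (hq : 0 < q) (hω : 0 < ω)
    (hden : ∀ (n : ℤ) (t : ℝ), Real.cos (ω * t) + GKM q ω * Real.cosh (rKM q ω * n) ≠ 0) :
    ∀ (n : ℤ) (t : ℝ),
      DifferentiableAt ℝ (fun s => ψKM q ω n s) t ∧
      Complex.I * deriv (fun s => ψKM q ω n s) t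
          + ψKM q ω (n + 1) t - 2 * ψKM q ω n t + ψKM q ω (n - 1) t
          - 2 * (q : ℂ) ^ 2 * ψKM q ω n t
          + (‖ψKM q ω n t‖ : ℂ) ^ 2 * (ψKM q ω (n + 1) t + ψKM q ω (n - 1) t) = 0 := by
  intro n t
  set c : ℝ := Real.cos (ω * t) with hc
  set H : ℝ := GKM q ω * Real.cosh (rKM q ω * n) with hH
  set L : ℝ := GKM q ω * Real.sinh (rKM q ω * n) * Real.sinh (rKM q ω) with hL
  have hadd : GKM q ω * Real.cosh (rKM q ω * (n + 1 : ℤ)) = H * Real.cosh (rKM q ω) + L := by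
    push_cast
    rw [mul_add, mul_one, Real.cosh_add]
    ring
  have hsub : GKM q ω * Real.cosh (rKM q ω * (n - 1 : ℤ)) = H * Real.cosh (rKM q ω) - L := by
    push_cast
    rw [mul_sub, mul_one, Real.cosh_sub]
    ring
  have hD : (c : ℂ) + H ≠ 0 := by exact_mod_cast hden n t
  have hDp : (c : ℂ) + (H * Real.cosh (rKM q ω) + L) ≠ 0 := by
    have h := hden (n + 1) t
    rw [hadd] at h
    exact_mod_cast h
  have hDm : (c : ℂ) + (H * Real.cosh (rKM q ω) - L) ≠ 0 := by
    have h := hden (n - 1) t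
    rw [hsub] at h
    exact_mod_cast h
  have hder := hasDerivAt_ψKM (q := q) hD
  refine ⟨hder.differentiableAt, ?_⟩
  have hω' : (ω : ℂ) = -2 * (q : ℂ) ^ 2 * Real.sinh (θKM q ω) := by
    rw [sinh_θKM]
    push_cast
    have : (q : ℂ) ≠ 0 := by exact_mod_cast hq.ne'
    field_simp
  have hcs : (c : ℂ) ^ 2 + (Real.sin (ω * t) : ℂ) ^ 2 = 1 := by
    exact_mod_cast Real.cos_sq_add_sin_sq (ω * t)
  have hCS : (Real.cosh (θKM q ω) : ℂ) ^ 2 - (Real.sinh (θKM q ω) : ℂ) ^ 2 = 1 := by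
    exact_mod_cast Real.cosh_sq_sub_sinh_sq (θKM q ω)
  have hK : (1 + q ^ 2) * (Real.cosh (rKM q ω) - 1) = q ^ 2 * (Real.cosh (θKM q ω) - 1) := by
    rw [cosh_rKM hq, mKM]
    field_simp
    ring
  have hLsq : (1 + q ^ 2) * L ^ 2 = (1 + q ^ 2) * (H ^ 2 * (Real.cosh (rKM q ω) ^ 2 - 1))
      - q ^ 2 * Real.sinh (θKM q ω) ^ 2 := by
    rw [← GKM_sq_mul_sinh_sq hq hω, hL, hH]
    linear_combination (1 + q ^ 2) * GKM q ω ^ 2 *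
      (Real.sinh (rKM q ω) ^ 2 * (-Real.cosh_sq (rKM q ω * n))
        - Real.cosh (rKM q ω * n) ^ 2 * Real.cosh_sq (rKM q ω))
  have key := ablowitzLadik_identity (q := q) hcs hCS
    (by exact_mod_cast hK) (by exact_mod_cast hLsq) hD hDp hDm
  rw [hder.deriv, norm_ψKM_sq, ψKM_eq, ψKM_eq, ψKM_eq, hadd, hsub, ← hc, ← hH]
  simp only [Complex.ofReal_add, Complex.ofReal_sub, Complex.ofReal_mul (H : ℝ)]
  rw [← hω'] at key
  exact key
end
end
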